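/- Let A be a unital *-algebra over ℂ and ω : A → ℂ a positive linear functional, with GNS representation (H_ω, π_ω) and cyclic vector [1]. Suppose π is a *-representation of A on a pre-Hilbert space H over ℂ (a ℂ-algebra homomorphism into adjointable operators with π(a)* = π(a*)) with a vector Ω ∈ H such that the set {π(a)Ω : a ∈ A} spans H and ω(a) = ⟨Ω, π(a)Ω⟩ for all a ∈ A. Then there is a ℂ-linear bijection U : H_ω → H with ⟨Ux, Uy⟩ = ⟨x, y⟩ for all x, y ∈ H_ω, U[1] = Ω, and U ∘ π_ω(a) = π(a) ∘ U for all a ∈ A. -/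

import Mathlib

open ComplexOrder

/-- Let `A` be a unital `*`-algebra over `ℂ` and `ω` a positive linear
functional, with GNS data: Gel'fand ideal `J`, GNS space `A ⧸ J` with inner product
`Bω ([a],[b]) = ω (a* b)` (the GNS representation is `[b] ↦ [a·b]` with cyclic
vector `[1]`).  Suppose `π` is a `*`-representation of `A` on a pre-Hilbert space
`(H, B)` over `ℂ` with a vector `Ω` such that `{π(a)Ω}` spans `H` and
`ω(a) = ⟨Ω, π(a)Ω⟩`.  Then there is a `ℂ`-linear bijection `U : A ⧸ J → H`
preserving inner products, with `U [1] = Ω` and intertwining the GNS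
representation with `π`, i.e. `U [a·b] = π(a) (U [b])`. -/
theorem gns_representation_unique_up_to_unitary
    {A H : Type*} [Ring A] [Algebra ℂ A] [StarRing A] [StarModule ℂ A]
    [AddCommGroup H] [Module ℂ H]
    (ω : A →ₗ[ℂ] ℂ) (hpos : ∀ a : A, 0 ≤ ω (star a * a))
    (J : Submodule ℂ A) (hJ : ∀ a : A, a ∈ J ↔ ω (star a * a) = 0)
    (Bω : (A ⧸ J) → (A ⧸ J) → ℂ)
    (hBω : ∀ a b : A, Bω (Submodule.Quotient.mk a) (Submodule.Quotient.mk b) = ω (star a * b))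
    (B : H → H → ℂ)
    (hB_add : ∀ x y z : H, B x (y + z) = B x y + B x z)
    (hB_smul : ∀ (c : ℂ) (x y : H), B x (c • y) = c * B x y)
    (hB_herm : ∀ x y : H, B x y = starRingEnd ℂ (B y x))
    (hB_pos : ∀ x : H, x ≠ 0 → 0 < B x x)
    (π : A →ₐ[ℂ] Module.End ℂ H)
    (hπ_star : ∀ (a : A) (x y : H), B (π (star a) x) y = B x (π a y))
    (Ω : H)
    (hcyc : Submodule.span ℂ (Set.range fun a : A => π a Ω) = ⊤)
    (hω : ∀ a : A, ω a = B Ω (π a Ω)) :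
    ∃ U : (A ⧸ J) →ₗ[ℂ] H,
      Function.Bijective U ∧
      (∀ x y : A ⧸ J, B (U x) (U y) = Bω x y) ∧
      U (Submodule.Quotient.mk 1) = Ω ∧
      (∀ a b : A, U (Submodule.Quotient.mk (a * b)) = π a (U (Submodule.Quotient.mk b))) := by
  let f : A →ₗ[ℂ] H := LinearMap.applyₗ Ω ∘ₗ π.toLinearMap
  have hf (a : A) : f a = π a Ω := rfl
  have hinner (a b : A) : B (f a) (f b) = ω (star a * b) := by
    have h := hπ_star (star a) Ω (π b Ω)
    rw [star_star] at h
    rw [hf, hf, h, hω, map_mul, Module.End.mul_apply]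
  have hB_self (x : H) : B x x = 0 ↔ x = 0 := by
    refine ⟨fun h => ?_, ?_⟩
    · by_contra hx
      exact (hB_pos x hx).ne' h
    · rintro rfl
      simpa using hB_smul 0 0 0
  have hker : J = LinearMap.ker f := by
    ext a
    rw [hJ, ← hinner, hB_self, LinearMap.mem_ker]
  have hsurj : Function.Surjective f := by
    rw [← LinearMap.range_eq_top, ← hcyc]
    exact (Submodule.span_eq (LinearMap.range f)).symm
  refine ⟨J.liftQ f hker.le, ⟨?_, ?_⟩, ?_, ?_, ?_⟩
  · rw [← LinearMap.ker_eq_bot]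
    exact Submodule.ker_liftQ_eq_bot _ _ _ hker.ge
  · intro x
    obtain ⟨a, rfl⟩ := hsurj x
    exact ⟨Submodule.Quotient.mk a, Submodule.liftQ_apply _ _ _⟩
  · intro x y
    obtain ⟨a, rfl⟩ := Submodule.Quotient.mk_surjective J x
    obtain ⟨b, rfl⟩ := Submodule.Quotient.mk_surjective J y
    rw [hBω, ← hinner]
    rfl
  · change π 1 Ω = Ω
    simp
  · intro a b
    change π (a * b) Ω = π a (π b Ω)
    rw [map_mul, Module.End.mul_apply]
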